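/- arXiv:1805.05104 — 2 statements merged into one kernel-verified Lean document; each statement's English description precedes it below -/
import Mathlib

section
/- Let s be a finite-dimensional simple Lie algebra over a field K of characteristic zero and let n = s ⊕ s, with simple ideals s₁ = s ⊕ 0 and s₂ = 0 ⊕ s. Let R be a Rota–Baxter operator of weight 1 on n such that the Lie algebra g given by the induced bracket [x,y] = {R(x), y} − {R(y), x} + {x, y} is isomorphic to n. Then, up to permuting the two factors of n and up to replacing R by −R − id, the operator R is either trivial (R = 0 or R = −id) or is given by one of the following formulas for some automorphism ψ of s: R((s₁, s₂)) = (−s₁, −ψ(s₁)), or R((s₁, s₂)) = (0, ψ(s₁)), or R((s₁, s₂)) = (−s₁, 0). -/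
/-- A Lie bracket on the `K`-vector space `V`, given as a plain binary product:
it is `K`-bilinear, alternating, and satisfies the Jacobi identity
(in Leibniz form). -/
def IsLieBr (K : Type*) {V : Type*} [Field K] [CharZero K] [AddCommGroup V] [Module K V]
    (b : V → V → V) : Prop :=
  (∀ x : V, IsLinearMap K (b x)) ∧ (∀ y : V, IsLinearMap K fun x => b x y) ∧
  (∀ x : V, b x x = 0) ∧ ∀ x y z : V, b x (b y z) = b (b x y) z + b y (b x z)

/-- A Rota–Baxter operator of weight `lam` on the Lie algebra `(V, b)`. -/
def IsLieRB (K : Type*) {V : Type*} [Field K] [CharZero K] [AddCommGroup V] [Module K V]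
    (b : V → V → V) (R : V →ₗ[K] V) (lam : K) : Prop :=
  ∀ x y : V, b (R x) (R y) = R (b (R x) y + b x (R y) + lam • b x y)

/-- The bracket `[x,y] = {R x, y} - {R y, x} + {x, y}` induced by an operator `R`
on a Lie algebra `(V, b)`. -/
def indBr {K V : Type*} [Field K] [CharZero K] [AddCommGroup V] [Module K V]
    (b : V → V → V) (R : V →ₗ[K] V) : V → V → V :=
  fun x y => b (R x) y - b (R y) x + b x y

/-- A post-Lie algebra structure on the pair of Lie algebras `(V, gb)` and `(V, nb)`:
a bilinear product `mul` with `x·y - y·x = [x,y] - {x,y}`, `[x,y]·z = x·(y·z) - y·(x·z)`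
and `x·{y,z} = {x·y, z} + {y, x·z}`. -/
def IsPostLie (K : Type*) {V : Type*} [Field K] [CharZero K] [AddCommGroup V] [Module K V]
    (gb nb mul : V → V → V) : Prop :=
  (∀ x : V, IsLinearMap K (mul x)) ∧ (∀ y : V, IsLinearMap K fun x => mul x y) ∧
  (∀ x y : V, mul x y - mul y x = gb x y - nb x y) ∧
  (∀ x y z : V, mul (gb x y) z = mul x (mul y z) - mul y (mul x z)) ∧
  (∀ x y z : V, mul x (nb y z) = nb (mul x y) z + nb y (mul x z))

/-- An ideal of the Lie algebra `(V, b)`. -/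
def IsLieIdeal (K : Type*) {V : Type*} [Field K] [CharZero K] [AddCommGroup V] [Module K V]
    (b : V → V → V) (I : Submodule K V) : Prop :=
  ∀ x : V, ∀ y ∈ I, b x y ∈ I

/-- The Lie algebra `(V, b)` is simple: it is non-abelian and has no ideals
other than `⊥` and `⊤`. -/
def IsSimpleBr (K : Type*) {V : Type*} [Field K] [CharZero K] [AddCommGroup V] [Module K V]
    (b : V → V → V) : Prop :=
  (∃ x y : V, b x y ≠ 0) ∧
  ∀ I : Submodule K V, IsLieIdeal K b I → I = ⊥ ∨ I = ⊤

/-- An isomorphism of the Lie algebras `(V, b)` and `(W, b')`. -/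
def LieBrIso (K : Type*) {V W : Type*} [Field K] [CharZero K] [AddCommGroup V] [Module K V]
    [AddCommGroup W] [Module K W] (b : V → V → V) (b' : W → W → W) : Prop :=
  ∃ e : V ≃ₗ[K] W, ∀ x y : V, e (b x y) = b' (e x) (e y)

/-- The operator `R` on `s ⊕ s` is trivial (`R = 0` or `R = -id`) or has one of
the three special forms `(s₁, s₂) ↦ (-s₁, -ψ(s₁))`, `(s₁, s₂) ↦ (0, ψ(s₁))`,
`(s₁, s₂) ↦ (-s₁, 0)` for an automorphism `ψ` of `s`. -/
def IsSpecialRBForm (K : Type*) {S : Type*} [Field K] [CharZero K] [AddCommGroup S] [Module K S]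
    (sb : S → S → S) (R : S × S →ₗ[K] S × S) : Prop :=
  R = 0 ∨ R = -LinearMap.id ∨
  ∃ ψ : S ≃ₗ[K] S, (∀ x y : S, ψ (sb x y) = sb (ψ x) (ψ y)) ∧
    ((∀ a : S × S, R a = (-a.1, -ψ a.1)) ∨
     (∀ a : S × S, R a = (0, ψ a.1)) ∨
     (∀ a : S × S, R a = (-a.1, 0)))

theorem Int.isJacobsonRing : IsJacobsonRing ℤ := by
  rw [isJacobsonRing_iff_prime_eq]
  intro P hP
  by_cases h : P = ⊥
  · subst h
    refine le_antisymm (fun x hx => ?_) Ideal.le_jacobson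
    have := Ideal.mem_jacobson_bot.mp hx x
    rw [Int.isUnit_iff] at this
    rw [Ideal.mem_bot]
    rcases this with h | h
    · simpa using h
    · nlinarith [mul_self_nonneg x]
  · have := hP.isMaximal h
    exact Ideal.jacobson_eq_self_of_isMaximal

theorem Field.finite_of_finiteType_int {k : Type*} [Field k]
    (hk : (algebraMap ℤ k).FiniteType) : Finite k := by
  have := RingHom.finiteType_algebraMap.mp hk
  have := Int.isJacobsonRing
  have : Module.Finite ℤ k := finite_of_finite_type_of_isJacobsonRing ℤ k
  have : Algebra.IsIntegral ℤ k := inferInstance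
  obtain ⟨p, hp⟩ := CharP.exists k
  have hp0 : p ≠ 0 := by
    rintro rfl
    have : CharZero k := CharP.charP_to_charZero k
    exact Int.not_isField (isField_of_isIntegral_of_isField
      (FaithfulSMul.algebraMap_injective ℤ k) (Field.toIsField k))
  refine Module.finite_of_fg_torsion k fun x => ⟨⟨(p : ℤ), ?_⟩, ?_⟩
  · simpa using hp0
  · simp [Submonoid.smul_def]

theorem Ideal.finite_quotient_of_finiteType_int {A : Type*} [CommRing A] [Algebra.FiniteType ℤ A]
    (m : Ideal A) [m.IsMaximal] : Finite (A ⧸ m) := by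
  let := Ideal.Quotient.field m
  have h : ((Ideal.Quotient.mk m).comp (algebraMap ℤ A)).FiniteType :=
    (RingHom.FiniteType.of_surjective _ Ideal.Quotient.mk_surjective).comp
      (RingHom.finiteType_algebraMap.mpr inferInstance)
  exact Field.finite_of_finiteType_int (RingHom.ext_int _ (algebraMap ℤ (A ⧸ m)) ▸ h)

/-- Finitely many elements of a field other than `0` and `1` can be assigned nonzero residues
modulo some `n`, compatibly with multiplication. -/
theorem Field.exists_log_modEq {F : Type*} [Field F] {T : Set F} (hT : T.Finite)
    (h0 : ∀ x ∈ T, x ≠ 0) (h1 : ∀ x ∈ T, x ≠ 1) :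
    ∃ (n : ℕ) (d : F → ℕ), (∀ x ∈ T, 0 < d x ∧ d x < n) ∧
      ∀ x ∈ T, ∀ y ∈ T, x * y ∈ T → d (x * y) ≡ d x + d y [MOD n] := by
  let A := Algebra.adjoin ℤ (T ∪ ((·⁻¹) '' T ∪ (fun x => (x - 1)⁻¹) '' T))
  have : Algebra.FiniteType ℤ A := A.fg_iff_finiteType.mp
    (Subalgebra.fg_def.mpr ⟨_, hT.union ((hT.image _).union (hT.image _)), rfl⟩)
  obtain ⟨m, hm⟩ := Ideal.exists_maximal A
  let := Ideal.Quotient.field m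
  have hfin : Finite (A ⧸ m) := m.finite_quotient_of_finiteType_int
  let ρ := Ideal.Quotient.mk m
  have hTA : ∀ x ∈ T, x ∈ A := fun x hx => Algebra.subset_adjoin (Or.inl hx)
  have hunit : ∀ x : A, (x : F) ≠ 0 → (x : F)⁻¹ ∈ A → ρ x ≠ 0 := by
    intro x hx hx' h
    have : ρ x * ρ ⟨_, hx'⟩ = 1 := by
      rw [← map_mul, ← map_one ρ]
      congr 1
      exact Subtype.ext (mul_inv_cancel₀ hx)
    simp [h] at this
  have hρ0 : ∀ x (hx : x ∈ T), ρ ⟨x, hTA x hx⟩ ≠ 0 := fun x hx =>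
    hunit _ (h0 x hx) (Algebra.subset_adjoin (Or.inr (Or.inl ⟨x, hx, rfl⟩)))
  have hρ1 : ∀ x (hx : x ∈ T), ρ ⟨x, hTA x hx⟩ ≠ 1 := by
    intro x hx h
    refine hunit (⟨x, hTA x hx⟩ - 1) (sub_ne_zero.mpr (h1 x hx))
      (Algebra.subset_adjoin (Or.inr (Or.inr ⟨x, hx, rfl⟩))) ?_
    rw [map_sub, h, map_one, sub_self]
  obtain ⟨g, hg⟩ := IsCyclic.exists_generator (α := (A ⧸ m)ˣ)
  have hlog : ∀ x : F, ∃ i : ℕ, ∀ hx : x ∈ T,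
      i < orderOf g ∧ (g ^ i : (A ⧸ m)ˣ) = Units.mk0 _ (hρ0 x hx) := by
    intro x
    by_cases hx : x ∈ T
    · obtain ⟨i, hi⟩ := mem_powers_iff_mem_zpowers.mpr (hg (Units.mk0 _ (hρ0 x hx)))
      refine ⟨i % orderOf g, fun _ => ⟨Nat.mod_lt _ (orderOf_pos g), ?_⟩⟩
      rw [pow_mod_orderOf]
      exact hi
    · exact ⟨0, fun h => absurd h hx⟩
  choose d hd using hlog
  refine ⟨orderOf g, d, fun x hx => ⟨?_, (hd x hx).1⟩, fun x hx y hy hxy => ?_⟩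
  · refine Nat.pos_of_ne_zero fun h => hρ1 x hx ?_
    have := (hd x hx).2
    rw [h, pow_zero] at this
    simpa using (congrArg Units.val this).symm
  · rw [← pow_eq_pow_iff_modEq, pow_add, (hd _ hxy).2, (hd x hx).2, (hd y hy).2]
    ext
    simp only [Units.val_mk0, Units.val_mul, ← map_mul]
    rfl

theorem iSupIndep.eq_of_le_of_iSup_eq_top {ι α : Type*} [CompleteLattice α] [IsModularLattice α]
    {E E' : ι → α} (hE : iSupIndep E) (hle : ∀ i, E' i ≤ E i) (htop : ⨆ i, E' i = ⊤) (i : ι) :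
    E' i = E i := by
  have h1 : E' i ⊔ ⨆ j, ⨆ (_ : j ≠ i), E' j = ⊤ := by
    rw [← htop, ← iSup_split_single]
  have h2 : (⨆ j, ⨆ (_ : j ≠ i), E' j) ⊓ E i = ⊥ := by
    have := (hE i).mono_right (iSup₂_mono fun j (_ : j ≠ i) => hle j)
    rw [inf_comm]
    exact this.eq_bot
  calc E' i = E' i ⊔ ((⨆ j, ⨆ (_ : j ≠ i), E' j) ⊓ E i) := by rw [h2, sup_bot_eq]
    _ = E i := by rw [← sup_inf_assoc_of_le _ (hle i), h1, top_inf_eq]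

/-- If a perfect Lie algebra is generated by `X`, then it is spanned by the brackets with right
entry in `X`. -/
theorem LieAlgebra.span_lie_generators_eq_top {F L : Type*} [CommRing F] [LieRing L]
    [LieAlgebra F L] {X : Set L} (hX : LieSubalgebra.lieSpan F L X = ⊤)
    (hL : Submodule.span F {z : L | ∃ u v : L, ⁅u, v⁆ = z} = ⊤) :
    Submodule.span F {z : L | ∃ u : L, ∃ v ∈ X, ⁅u, v⁆ = z} = ⊤ := by
  set W := Submodule.span F {z : L | ∃ u : L, ∃ v ∈ X, ⁅u, v⁆ = z} with hW
  let N : LieSubalgebra F L :=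
    { carrier := {v | ∀ u : L, ⁅u, v⁆ ∈ W}
      add_mem' := fun ha hb u => by rw [lie_add]; exact W.add_mem (ha u) (hb u)
      zero_mem' := fun u => by rw [lie_zero]; exact W.zero_mem
      smul_mem' := fun c x hx u => by rw [lie_smul]; exact W.smul_mem c (hx u)
      lie_mem' := fun {v w} hv hw u => by
        rw [leibniz_lie, ← lie_skew v ⁅u, w⁆]
        exact W.add_mem (hw _) (W.neg_mem (hv _)) }
  have hN : N = ⊤ := top_le_iff.mp
    (hX ▸ LieSubalgebra.lieSpan_le.mpr fun v hv u => Submodule.subset_span ⟨u, v, hv, rfl⟩)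
  rw [eq_top_iff, ← hL, Submodule.span_le]
  rintro _ ⟨u, v, rfl⟩
  exact (hN ▸ LieSubalgebra.mem_top v : v ∈ N) u

/-- A form of Kreknin's theorem: a perfect Lie algebra with a grading whose support injects
multiplicatively into the nonzero residues modulo `n` is trivial. -/
theorem LieAlgebra.subsingleton_of_perfect_of_graded {F L ι : Type*} [Field F] [LieRing L]
    [LieAlgebra F L] [Mul ι] {E : ι → Submodule F L} (hind : iSupIndep E) (htop : ⨆ i, E i = ⊤)
    (hlie : ∀ i j, ∀ x ∈ E i, ∀ y ∈ E j, ⁅x, y⁆ ∈ E (i * j))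
    {n : ℕ} {d : ι → ℕ} (hd : ∀ i, E i ≠ ⊥ → 0 < d i ∧ d i < n)
    (hmul : ∀ i j, E i ≠ ⊥ → E j ≠ ⊥ → E (i * j) ≠ ⊥ → d (i * j) ≡ d i + d j [MOD n])
    (hL : Submodule.span F {z : L | ∃ u v : L, ⁅u, v⁆ = z} = ⊤) :
    Subsingleton L := by
  have key : ∀ k : ℕ, LieSubalgebra.lieSpan F L {x | ∃ i, k ≤ d i ∧ x ∈ E i} = ⊤ := by
    intro k
    induction k with
    | zero =>
      rw [← LieSubalgebra.toSubmodule_inj, LieSubalgebra.top_toSubmodule, eq_top_iff, ← htop]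
      exact iSup_le fun i x hx => LieSubalgebra.subset_lieSpan ⟨i, Nat.zero_le _, hx⟩
    | succ k ih =>
      set M := LieSubalgebra.lieSpan F L {x | ∃ i, k + 1 ≤ d i ∧ x ∈ E i} with hM
      have hEM : ∀ i, k + 1 ≤ d i → ∀ x ∈ E i, x ∈ M := fun i hi x hx =>
        LieSubalgebra.subset_lieSpan ⟨i, hi, hx⟩
      let E' : ι → Submodule F L := fun i => Submodule.span F
        {z | ∃ a b, a * b = i ∧ k ≤ d b ∧ ∃ u ∈ E a, ∃ v ∈ E b, ⁅u, v⁆ = z}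
      have hle : ∀ i, E' i ≤ E i := fun i => Submodule.span_le.mpr <| by
        rintro _ ⟨a, b, rfl, -, u, hu, v, hv, rfl⟩
        exact hlie a b u hu v hv
      have htop' : ⨆ i, E' i = ⊤ := by
        rw [eq_top_iff, ← LieAlgebra.span_lie_generators_eq_top ih hL, Submodule.span_le]
        rintro _ ⟨u, v, ⟨b, hb, hv⟩, rfl⟩
        have hu : u ∈ ⨆ i, E i := htop ▸ Submodule.mem_top
        induction hu using Submodule.iSup_induction' with
        | mem a x hx =>
          exact le_iSup E' (a * b) (Submodule.subset_span ⟨a, b, rfl, hb, x, hx, v, hv, rfl⟩)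
        | zero => rw [zero_lie]; exact Submodule.zero_mem _
        | add x y _ _ hx hy => rw [add_lie]; exact Submodule.add_mem _ hx hy
      have heq := hind.eq_of_le_of_iSup_eq_top hle htop'
      rw [eq_top_iff, ← ih, LieSubalgebra.lieSpan_le]
      rintro x ⟨i, hi, hx⟩
      rcases hi.lt_or_eq with hi | hi
      · exact hEM i hi x hx
      · rw [← heq i] at hx
        refine Submodule.span_le (p := M.toSubmodule).mpr ?_ hx
        rintro _ ⟨a, b, rfl, hb, u, hu, v, hv, rfl⟩
        by_cases hzero : ⁅u, v⁆ = 0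
        · rw [hzero]; exact M.zero_mem
        have ha' : E a ≠ ⊥ := fun h => hzero (by
          rw [(Submodule.mem_bot F).mp (h ▸ hu : u ∈ (⊥ : Submodule F L)), zero_lie])
        have hb' : E b ≠ ⊥ := fun h => hzero (by
          rw [(Submodule.mem_bot F).mp (h ▸ hv : v ∈ (⊥ : Submodule F L)), lie_zero])
        have hab' : E (a * b) ≠ ⊥ := fun h => hzero
          ((Submodule.mem_bot F).mp (h ▸ hlie a b u hu v hv))
        have hda := hd a ha'
        have hdb := hd b hb'
        have hcong := hmul a b ha' hb' hab'
        rw [← hi] at hcong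
        have hlt : k + 1 ≤ d a ∧ k + 1 ≤ d b := by
          obtain ⟨c, hc⟩ := (Nat.modEq_iff_dvd' (by omega)).mp hcong
          rcases c with _ | _ | c
          · omega
          · omega
          · have : n * (c + 1 + 1) = n * c + n + n := by ring
            have := Nat.zero_le (n * c)
            omega
        exact M.lie_mem (hEM a hlt.1 u hu) (hEM b hlt.2 v hv)
  have hbot : (⊤ : LieSubalgebra F L) ≤ ⊥ := by
    rw [← key n, LieSubalgebra.lieSpan_le]
    rintro x ⟨i, hi, hx⟩
    by_cases h : E i = ⊥
    · rw [h] at hx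
      exact hx
    · exact absurd (hd i h).2 (by omega)
  refine ⟨fun x y => ?_⟩
  rw [(LieSubalgebra.mem_bot x).mp (hbot (LieSubalgebra.mem_top x)),
    (LieSubalgebra.mem_bot y).mp (hbot (LieSubalgebra.mem_top y))]

theorem Module.End.lie_mem_maxGenEigenspace_mul {F L : Type*} [CommRing F] [LieRing L]
    [LieAlgebra F L] {f : Module.End F L} (hf : ∀ x y, f ⁅x, y⁆ = ⁅f x, f y⁆) {a b : F} {x y : L}
    (hx : x ∈ f.maxGenEigenspace a) (hy : y ∈ f.maxGenEigenspace b) :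
    ⁅x, y⁆ ∈ f.maxGenEigenspace (a * b) := by
  rw [Module.End.mem_maxGenEigenspace] at hx hy ⊢
  obtain ⟨i, hi⟩ := hx
  obtain ⟨j, hj⟩ := hy
  refine ⟨i + j, ?_⟩
  induction hm : i + j generalizing i j x y with
  | zero =>
    obtain rfl : i = 0 := by omega
    simp only [pow_zero, Module.End.one_apply] at hi ⊢
    rw [hi, zero_lie]
  | succ m ih =>
    rcases i with _ | i
    · simp only [pow_zero, Module.End.one_apply] at hi
      rw [hi, zero_lie, map_zero]
    rcases j with _ | j
    · simp only [pow_zero, Module.End.one_apply] at hj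
      rw [hj, lie_zero, map_zero]
    have hstep : (f - (a * b) • 1) ⁅x, y⁆ = ⁅(f - a • 1) x, f y⁆ + ⁅x, a • (f - b • 1) y⁆ := by
      simp only [LinearMap.sub_apply, LinearMap.smul_apply, Module.End.one_apply, hf, sub_lie,
        smul_lie, lie_smul, lie_sub, smul_sub, smul_smul]
      abel
    have hcomm : Commute (f - b • 1) f :=
      (Commute.refl f).sub_left ((Commute.one_left f).smul_left b)
    rw [pow_succ, Module.End.mul_apply, hstep, map_add, ih (x := (f - a • 1) x) i ?_ (j + 1) ?_ ?_,
      ih (y := a • (f - b • 1) y) (i + 1) hi j ?_ ?_, add_zero]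
    · rw [map_smul, ← Module.End.mul_apply, ← pow_succ, hj, smul_zero]
    · omega
    · rw [← Module.End.mul_apply, ← pow_succ, hi]
    · rw [← Module.End.mul_apply, (hcomm.pow_left _).eq, Module.End.mul_apply, hj, map_zero]
    · omega

theorem LieAlgebra.subsingleton_of_perfect_of_forall_eq_of_isAlgClosed {F L : Type*} [Field F]
    [IsAlgClosed F] [LieRing L] [LieAlgebra F L] [FiniteDimensional F L]
    (hL : Submodule.span F {z : L | ∃ u v : L, ⁅u, v⁆ = z} = ⊤) {f : Module.End F L}
    (hf : ∀ x y, f ⁅x, y⁆ = ⁅f x, f y⁆) (hinj : Function.Injective f)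
    (hfix : ∀ x, f x = x → x = 0) : Subsingleton L := by
  have hev : ∀ a, f.maxGenEigenspace a ≠ ⊥ → f.HasEigenvalue a := fun a ha =>
    Module.End.hasEigenvalue_of_hasGenEigenvalue (k := Module.finrank F L) <| by
      rw [Module.End.maxGenEigenspace_eq_genEigenspace_finrank] at ha
      exact ha
  have h0 : ∀ a ∈ {a | f.maxGenEigenspace a ≠ ⊥}, a ≠ 0 := by
    rintro a ha rfl
    obtain ⟨v, hv⟩ := (hev _ ha).exists_hasEigenvector
    exact hv.2 (hinj (by rw [hv.apply_eq_smul, zero_smul, map_zero]))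
  have h1 : ∀ a ∈ {a | f.maxGenEigenspace a ≠ ⊥}, a ≠ 1 := by
    rintro a ha rfl
    obtain ⟨v, hv⟩ := (hev _ ha).exists_hasEigenvector
    exact hv.2 (hfix v (by rw [hv.apply_eq_smul, one_smul]))
  obtain ⟨n, d, hd, hmul⟩ := Field.exists_log_modEq
    (WellFoundedGT.finite_ne_bot_of_iSupIndep f.independent_maxGenEigenspace) h0 h1
  exact LieAlgebra.subsingleton_of_perfect_of_graded f.independent_maxGenEigenspace
    f.iSup_maxGenEigenspace_eq_top
    (fun _ _ _ hx _ hy => Module.End.lie_mem_maxGenEigenspace_mul hf hx hy) hd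
    (fun a b ha hb hab => hmul a ha b hb hab) hL

/-- An automorphism of a nonzero perfect finite-dimensional Lie algebra has a nonzero fixed
point. -/
theorem LieAlgebra.exists_ne_zero_fixed_of_perfect {K L : Type*} [Field K] [LieRing L]
    [LieAlgebra K L] [FiniteDimensional K L] [Nontrivial L]
    (hL : Submodule.span K {z : L | ∃ u v : L, ⁅u, v⁆ = z} = ⊤) {f : Module.End K L}
    (hf : ∀ x y, f ⁅x, y⁆ = ⁅f x, f y⁆) (hinj : Function.Injective f) :
    ∃ x, x ≠ 0 ∧ f x = x := by
  by_contra! hfix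
  let F := AlgebraicClosure K
  have hfix' : Function.Injective ⇑(f - 1 : Module.End K L) := by
    rw [← LinearMap.ker_eq_bot, LinearMap.ker_eq_bot']
    intro x hx
    by_contra hne
    exact hfix x hne (sub_eq_zero.mp hx)
  suffices Subsingleton (TensorProduct K F L) from
    not_subsingleton (TensorProduct K F L) this
  refine LieAlgebra.subsingleton_of_perfect_of_forall_eq_of_isAlgClosed (F := F)
    (f := f.baseChange F) ?_ ?_ ?_ ?_
  · rw [eq_top_iff]
    rintro t -
    induction t using TensorProduct.induction_on with
    | zero => exact Submodule.zero_mem _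
    | add x y hx hy => exact Submodule.add_mem _ hx hy
    | tmul c x =>
      have hx : x ∈ Submodule.span K {z : L | ∃ u v : L, ⁅u, v⁆ = z} := hL ▸ Submodule.mem_top
      induction hx using Submodule.span_induction with
      | mem z hz =>
        obtain ⟨u, v, rfl⟩ := hz
        refine Submodule.subset_span ⟨c ⊗ₜ u, 1 ⊗ₜ v, ?_⟩
        rw [LieAlgebra.ExtendScalars.bracket_tmul, mul_one]
      | zero => rw [TensorProduct.tmul_zero]; exact Submodule.zero_mem _
      | add x y _ _ hx hy => rw [TensorProduct.tmul_add]; exact Submodule.add_mem _ hx hy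
      | smul r x _ hx =>
        rw [TensorProduct.tmul_smul, ← algebraMap_smul F r]
        exact Submodule.smul_mem _ _ hx
  · intro x y
    induction x using TensorProduct.induction_on with
    | zero => simp only [zero_lie, map_zero]
    | add x x' hx hx' => simp only [add_lie, map_add, hx, hx']
    | tmul c x =>
      induction y using TensorProduct.induction_on with
      | zero => simp only [lie_zero, map_zero]
      | add y y' hy hy' => simp only [lie_add, map_add, hy, hy']
      | tmul e y =>
        simp only [LieAlgebra.ExtendScalars.bracket_tmul, LinearMap.baseChange_tmul, hf]
  · exact Module.Flat.lTensor_preserves_injective_linearMap f hinj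
  · intro x hx
    have hinj' : Function.Injective ((f - 1 : Module.End K L).baseChange F) :=
      Module.Flat.lTensor_preserves_injective_linearMap (f - 1 : Module.End K L) hfix'
    refine hinj' ?_
    rw [LinearMap.baseChange_sub, LinearMap.sub_apply, hx, map_zero]
    have : (1 : Module.End K L).baseChange F = 1 := LinearMap.baseChange_id
    rw [this, Module.End.one_apply, sub_self]

theorem IsLieBr.exists_ne_zero_fixed {K S : Type*} [Field K] [CharZero K] [AddCommGroup S]
    [Module K S] [FiniteDimensional K S] {sb : S → S → S} (hsb : IsLieBr K sb)
    (hsimple : IsSimpleBr K sb) (ψ : S ≃ₗ[K] S) (hψ : ∀ x y, ψ (sb x y) = sb (ψ x) (ψ y)) :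
    ∃ x, x ≠ 0 ∧ ψ x = x := by
  obtain ⟨hr, hl, halt, hjac⟩ := hsb
  obtain ⟨⟨x₀, y₀, hne⟩, hideal⟩ := hsimple
  let : LieRing S :=
    { bracket := sb
      add_lie := fun x y z => (hl z).map_add x y
      lie_add := fun x y z => (hr x).map_add y z
      lie_self := halt
      leibniz_lie := hjac }
  let : LieAlgebra K S := { lie_smul := fun c x y => (hr x).map_smul c y }
  have : Nontrivial S := ⟨_, _, hne⟩
  refine LieAlgebra.exists_ne_zero_fixed_of_perfect (f := (ψ : S →ₗ[K] S)) ?_ hψ ψ.injective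
  refine (hideal _ fun x y _ => ?_).resolve_left fun h => hne ?_
  · exact Submodule.subset_span ⟨x, y, rfl⟩
  · rw [← Submodule.mem_bot K, ← h]
    exact Submodule.subset_span ⟨x₀, y₀, rfl⟩

/-- `u` is an automorphism of `(S, sb)` composed with the first projection. -/
def IsAutFst (K : Type*) {S : Type*} [Field K] [AddCommGroup S] [Module K S]
    (sb : S → S → S) (u : S × S → S) : Prop :=
  ∃ ψ : S ≃ₗ[K] S, (∀ x y, ψ (sb x y) = sb (ψ x) (ψ y)) ∧ ∀ a, u a = ψ a.1

/-- `u` is an automorphism of `(S, sb)` composed with the second projection. -/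
def IsAutSnd (K : Type*) {S : Type*} [Field K] [AddCommGroup S] [Module K S]
    (sb : S → S → S) (u : S × S → S) : Prop :=
  ∃ ψ : S ≃ₗ[K] S, (∀ x y, ψ (sb x y) = sb (ψ x) (ψ y)) ∧ ∀ a, u a = ψ a.2

section

variable {K S : Type*} [Field K] [AddCommGroup S] [Module K S] {sb : S → S → S}

theorem IsAutFst.comp_swap {u : S × S → S} (hu : IsAutFst K sb u) :
    IsAutSnd K sb (u ∘ Prod.swap) :=
  let ⟨ψ, hψ, h⟩ := hu
  ⟨ψ, hψ, fun a => h a.swap⟩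

theorem IsAutSnd.comp_swap {u : S × S → S} (hu : IsAutSnd K sb u) :
    IsAutFst K sb (u ∘ Prod.swap) :=
  let ⟨ψ, hψ, h⟩ := hu
  ⟨ψ, hψ, fun a => h a.swap⟩

theorem isAut_symm {ψ : S ≃ₗ[K] S} (hψ : ∀ x y, ψ (sb x y) = sb (ψ x) (ψ y)) (x y : S) :
    ψ.symm (sb x y) = sb (ψ.symm x) (ψ.symm y) := by
  rw [LinearEquiv.symm_apply_eq, hψ, ψ.apply_symm_apply, ψ.apply_symm_apply]

theorem isAut_trans {ψ χ : S ≃ₗ[K] S} (hψ : ∀ x y, ψ (sb x y) = sb (ψ x) (ψ y))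
    (hχ : ∀ x y, χ (sb x y) = sb (χ x) (χ y)) (x y : S) :
    (ψ.trans χ) (sb x y) = sb ((ψ.trans χ) x) ((ψ.trans χ) y) := by
  simp only [LinearEquiv.trans_apply, hψ, hχ]

variable [CharZero K] [FiniteDimensional K S]

theorem IsLieBr.exists_simultaneous_eq (hsb : IsLieBr K sb) (hsimple : IsSimpleBr K sb)
    {α β γ δ : S ≃ₗ[K] S} (hα : ∀ x y, α (sb x y) = sb (α x) (α y))
    (hβ : ∀ x y, β (sb x y) = sb (β x) (β y)) (hγ : ∀ x y, γ (sb x y) = sb (γ x) (γ y))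
    (hδ : ∀ x y, δ (sb x y) = sb (δ x) (δ y)) :
    ∃ a b, a ≠ 0 ∧ α a = β b ∧ γ a = δ b := by
  obtain ⟨a, ha, h⟩ := hsb.exists_ne_zero_fixed hsimple
    (((γ.trans δ.symm).trans β).trans α.symm)
    (isAut_trans (isAut_trans (isAut_trans hγ (isAut_symm hδ)) hβ) (isAut_symm hα))
  refine ⟨a, δ.symm (γ a), ha, ?_, (δ.apply_symm_apply _).symm⟩
  exact (α.symm_apply_eq.mp h).symm

theorem IsLieBr.not_surjective_sub (hsb : IsLieBr K sb) (hsimple : IsSimpleBr K sb)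
    {α β : S ≃ₗ[K] S} (hα : ∀ x y, α (sb x y) = sb (α x) (α y))
    (hβ : ∀ x y, β (sb x y) = sb (β x) (β y)) :
    ¬ Function.Surjective fun x => α x - β x := by
  intro h
  have hinj : Function.Injective ((α : S →ₗ[K] S) - (β : S →ₗ[K] S)) :=
    LinearMap.injective_iff_surjective.mpr h
  obtain ⟨a, b, ha, hab, hid⟩ := hsb.exists_simultaneous_eq hsimple hα hβ
    (γ := LinearEquiv.refl K S) (δ := LinearEquiv.refl K S) (fun _ _ => rfl) (fun _ _ => rfl)
  obtain rfl : a = b := hid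
  refine ha (hinj ?_)
  rw [map_zero]
  exact sub_eq_zero.mpr hab

theorem IsLieBr.endomorphism_eq_zero_or_equiv (hsb : IsLieBr K sb) (hsimple : IsSimpleBr K sb)
    {α : S →ₗ[K] S} (hα : ∀ x y, α (sb x y) = sb (α x) (α y)) :
    α = 0 ∨ ∃ ψ : S ≃ₗ[K] S, (ψ : S →ₗ[K] S) = α := by
  obtain h | h := hsimple.2 (LinearMap.ker α) fun x y hy => by
    rw [LinearMap.mem_ker] at hy ⊢
    rw [hα, hy, (hsb.1 _).map_zero]
  · exact Or.inr ⟨LinearEquiv.ofInjectiveEndo α (LinearMap.ker_eq_bot.mp h), rfl⟩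
  · exact Or.inl (LinearMap.ker_eq_top.mp h)

theorem IsLieBr.prod_hom_cases (hsb : IsLieBr K sb) (hsimple : IsSimpleBr K sb)
    {u : S × S →ₗ[K] S} (hu : ∀ x y : S × S, u (sb x.1 y.1, sb x.2 y.2) = sb (u x) (u y)) :
    (∀ a, u a = 0) ∨ IsAutFst K sb u ∨ IsAutSnd K sb u := by
  have hz : ∀ x, sb x 0 = 0 := fun x => (hsb.1 x).map_zero
  have hz' : ∀ x, sb 0 x = 0 := fun x => (hsb.2.1 x).map_zero
  have hsplit : ∀ a, u a = u (a.1, 0) + u (0, a.2) := fun a => by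
    rw [← map_add, Prod.mk_add_mk, add_zero, zero_add]
  have hfst : ∀ x y, u (sb x y, 0) = sb (u (x, 0)) (u (y, 0)) := fun x y => by
    rw [← hu, hz]
  have hsnd : ∀ x y, u (0, sb x y) = sb (u (0, x)) (u (0, y)) := fun x y => by
    rw [← hu, hz]
  have hcomm : ∀ x y, sb (u (x, 0)) (u (0, y)) = 0 := fun x y => by
    rw [← hu, hz, hz', Prod.mk_zero_zero, map_zero]
  obtain h1 | ⟨ψ, h1⟩ := hsb.endomorphism_eq_zero_or_equiv hsimple
    (α := u ∘ₗ LinearMap.inl K S S) hfst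
  · have h1' : ∀ x, u (x, 0) = 0 := LinearMap.congr_fun h1
    obtain h2 | ⟨χ, h2⟩ := hsb.endomorphism_eq_zero_or_equiv hsimple
      (α := u ∘ₗ LinearMap.inr K S S) hsnd
    · have h2' : ∀ x, u (0, x) = 0 := LinearMap.congr_fun h2
      exact Or.inl fun a => by rw [hsplit, h1', h2', add_zero]
    · have h2' : ∀ x, χ x = u (0, x) := LinearMap.congr_fun h2
      exact Or.inr (Or.inr ⟨χ, fun x y => by rw [h2', h2', h2', hsnd],
        fun a => by rw [hsplit, h1', h2', zero_add]⟩)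
  · have h1' : ∀ x, ψ x = u (x, 0) := LinearMap.congr_fun h1
    obtain h2 | ⟨χ, h2⟩ := hsb.endomorphism_eq_zero_or_equiv hsimple
      (α := u ∘ₗ LinearMap.inr K S S) hsnd
    · have h2' : ∀ x, u (0, x) = 0 := LinearMap.congr_fun h2
      exact Or.inr (Or.inl ⟨ψ, fun x y => by rw [h1', h1', h1', hfst],
        fun a => by rw [hsplit, h1', h2', add_zero]⟩)
    · have h2' : ∀ x, χ x = u (0, x) := LinearMap.congr_fun h2
      obtain ⟨x, y, hne⟩ := hsimple.1
      refine absurd (hcomm (ψ.symm x) (χ.symm y)) ?_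
      rwa [← h1', ← h2', ψ.apply_symm_apply, χ.apply_symm_apply]

end

section

variable {K S : Type*} [Field K] [AddCommGroup S] [Module K S] {sb : S → S → S}

/-- `R` is of special form up to swapping the two factors and up to replacing it by `-R - id`. -/
def IsSpecialUpToSymm (K : Type*) {S : Type*} [Field K] [CharZero K] [AddCommGroup S] [Module K S]
    (sb : S → S → S) (R : S × S →ₗ[K] S × S) : Prop :=
  IsSpecialRBForm K sb R ∨
    IsSpecialRBForm K sb
      ((LinearEquiv.prodComm K S S).toLinearMap ∘ₗ R ∘ₗ (LinearEquiv.prodComm K S S).toLinearMap) ∨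
    IsSpecialRBForm K sb (-R - LinearMap.id) ∨
    IsSpecialRBForm K sb
      ((LinearEquiv.prodComm K S S).toLinearMap ∘ₗ (-R - LinearMap.id) ∘ₗ
        (LinearEquiv.prodComm K S S).toLinearMap)

theorem IsSpecialUpToSymm.of_neg_sub_id [CharZero K] {R : S × S →ₗ[K] S × S}
    (h : IsSpecialUpToSymm K sb (-R - LinearMap.id)) : IsSpecialUpToSymm K sb R := by
  have hR : -(-R - LinearMap.id) - LinearMap.id = R := by abel
  unfold IsSpecialUpToSymm at h ⊢
  rw [hR] at h
  tauto

theorem IsSpecialUpToSymm.of_swap [CharZero K] {R : S × S →ₗ[K] S × S}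
    (h : IsSpecialUpToSymm K sb ((LinearEquiv.prodComm K S S).toLinearMap ∘ₗ R ∘ₗ
      (LinearEquiv.prodComm K S S).toLinearMap)) : IsSpecialUpToSymm K sb R := by
  set τ := (LinearEquiv.prodComm K S S).toLinearMap with hτ
  have hR : ∀ Q : S × S →ₗ[K] S × S, τ ∘ₗ (τ ∘ₗ Q ∘ₗ τ) ∘ₗ τ = Q := fun Q => rfl
  have hR' : -(τ ∘ₗ R ∘ₗ τ) - LinearMap.id = τ ∘ₗ (-R - LinearMap.id) ∘ₗ τ := by
    ext <;> simp [hτ]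
  unfold IsSpecialUpToSymm at h ⊢
  rw [← hτ] at h ⊢
  rw [hR', hR, hR] at h
  tauto

/-- The pair `u = (f₁, f₂)`, `v = (h₁, h₂)` parametrises `R`: the map `v - u` is bijective, and
`R (v a - u a) = u a`. -/
structure IsParametrised (R : S × S →ₗ[K] S × S) (f₁ h₁ f₂ h₂ : S × S → S) : Prop where
  injective : ∀ a, h₁ a = f₁ a → h₂ a = f₂ a → a = 0
  surjective : ∀ p : S × S, ∃ a, (h₁ a - f₁ a, h₂ a - f₂ a) = p
  apply_sub : ∀ a, R (h₁ a - f₁ a, h₂ a - f₂ a) = (f₁ a, f₂ a)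

namespace IsParametrised

variable {R : S × S →ₗ[K] S × S} {f₁ h₁ f₂ h₂ : S × S → S}

theorem surjective_fst (H : IsParametrised R f₁ h₁ f₂ h₂) (x : S) : ∃ a, h₁ a - f₁ a = x :=
  (H.surjective (x, 0)).imp fun _ h => congrArg Prod.fst h

theorem comp_swap (H : IsParametrised R f₁ h₁ f₂ h₂) :
    IsParametrised R (f₁ ∘ Prod.swap) (h₁ ∘ Prod.swap) (f₂ ∘ Prod.swap) (h₂ ∘ Prod.swap) where
  injective a h h' := Prod.swap_injective (H.injective a.swap h h')
  surjective p := let ⟨a, ha⟩ := H.surjective p; ⟨a.swap, ha⟩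
  apply_sub a := H.apply_sub a.swap

theorem swap (H : IsParametrised R f₁ h₁ f₂ h₂) :
    IsParametrised ((LinearEquiv.prodComm K S S).toLinearMap ∘ₗ R ∘ₗ
      (LinearEquiv.prodComm K S S).toLinearMap) f₂ h₂ f₁ h₁ where
  injective a h h' := H.injective a h' h
  surjective p := (H.surjective p.swap).imp fun _ ha => congrArg Prod.swap ha
  apply_sub a := congrArg Prod.swap (H.apply_sub a)

theorem neg_sub_id (H : IsParametrised R f₁ h₁ f₂ h₂) :
    IsParametrised (-R - LinearMap.id) h₁ f₁ h₂ f₂ where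
  injective a h h' := H.injective a h.symm h'.symm
  surjective p := (H.surjective (-p)).imp fun a ha => by
    rw [← neg_eq_iff_eq_neg] at ha
    rw [← ha, Prod.neg_mk, neg_sub, neg_sub]
  apply_sub a := by
    have h : ((f₁ a - h₁ a, f₂ a - h₂ a) : S × S) = -(h₁ a - f₁ a, h₂ a - f₂ a) := by
      rw [Prod.neg_mk, neg_sub, neg_sub]
    rw [h, map_neg, LinearMap.sub_apply, LinearMap.neg_apply, H.apply_sub, LinearMap.id_apply,
      Prod.neg_mk, Prod.mk_sub_mk, Prod.neg_mk]
    ext <;> simp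

/-- The possible shapes of one component of a parametrisation. -/
def Shape (K : Type*) {S : Type*} [Field K] [AddCommGroup S] [Module K S] (sb : S → S → S)
    (f h : S × S → S) : Prop :=
  ((∀ a, f a = 0) ∧ IsAutFst K sb h) ∨ ((∀ a, f a = 0) ∧ IsAutSnd K sb h) ∨
  (IsAutFst K sb f ∧ (∀ a, h a = 0)) ∨ (IsAutSnd K sb f ∧ (∀ a, h a = 0)) ∨
  (IsAutFst K sb f ∧ IsAutSnd K sb h) ∨ (IsAutSnd K sb f ∧ IsAutFst K sb h)

theorem shape [CharZero K] [FiniteDimensional K S] (hsb : IsLieBr K sb) (hsimple : IsSimpleBr K sb)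
    {f h : S × S →ₗ[K] S}
    (hf : ∀ x y : S × S, f (sb x.1 y.1, sb x.2 y.2) = sb (f x) (f y))
    (hh : ∀ x y : S × S, h (sb x.1 y.1, sb x.2 y.2) = sb (h x) (h y))
    (hsurj : ∀ x, ∃ a, h a - f a = x) : Shape K sb f h := by
  rcases hsb.prod_hom_cases hsimple hf with hf' | hf' | hf' <;>
  rcases hsb.prod_hom_cases hsimple hh with hh' | hh' | hh'
  · obtain ⟨x, y, hne⟩ := hsimple.1
    obtain ⟨a, ha⟩ := hsurj (sb x y)
    rw [hf', hh', sub_zero] at ha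
    exact absurd ha.symm hne
  · exact Or.inl ⟨hf', hh'⟩
  · exact Or.inr (Or.inl ⟨hf', hh'⟩)
  · exact Or.inr (Or.inr (Or.inl ⟨hf', hh'⟩))
  · obtain ⟨α, hα, hf'⟩ := hf'
    obtain ⟨β, hβ, hh'⟩ := hh'
    refine absurd (fun x => ?_) (hsb.not_surjective_sub hsimple hβ hα)
    obtain ⟨a, ha⟩ := hsurj x
    exact ⟨a.1, by rw [← ha, hf', hh']⟩
  · exact Or.inr (Or.inr (Or.inr (Or.inr (Or.inl ⟨hf', hh'⟩))))
  · exact Or.inr (Or.inr (Or.inr (Or.inl ⟨hf', hh'⟩)))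
  · exact Or.inr (Or.inr (Or.inr (Or.inr (Or.inr ⟨hf', hh'⟩))))
  · obtain ⟨α, hα, hf'⟩ := hf'
    obtain ⟨β, hβ, hh'⟩ := hh'
    refine absurd (fun x => ?_) (hsb.not_surjective_sub hsimple hβ hα)
    obtain ⟨a, ha⟩ := hsurj x
    exact ⟨a.2, by rw [← ha, hf', hh']⟩

theorem isSpecial_of_zero_autFst [CharZero K] (H : IsParametrised R f₁ h₁ f₂ h₂)
    (hsimple : IsSimpleBr K sb)
    (hf₁ : ∀ a, f₁ a = 0) (hh₁ : IsAutFst K sb h₁) (h₂' : Shape K sb f₂ h₂) :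
    IsSpecialUpToSymm K sb R := by
  obtain ⟨α, hα, hh₁⟩ := hh₁
  have hker : (∀ a, f₂ a = 0) ∧ IsAutFst K sb h₂ ∨ IsAutFst K sb f₂ ∧ (∀ a, h₂ a = 0) → False := by
    intro h
    obtain ⟨x, y, hne⟩ := hsimple.1
    refine hne (congrArg Prod.snd (H.injective (0, sb x y) ?_ ?_))
    · rw [hf₁, hh₁, map_zero]
    · rcases h with ⟨hf₂, ψ, -, hh₂⟩ | ⟨⟨ψ, -, hf₂⟩, hh₂⟩ <;> rw [hf₂, hh₂, map_zero]
  rcases h₂' with h | ⟨hf₂, hh₂⟩ | h | ⟨⟨β, hβ, hf₂⟩, hh₂⟩ | ⟨⟨γ, hγ, hf₂⟩, δ, hδ, hh₂⟩ |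
    ⟨⟨γ, hγ, hf₂⟩, δ, hδ, hh₂⟩
  · exact (hker (Or.inl h)).elim
  · refine Or.inl (Or.inl (LinearMap.ext fun p => ?_))
    obtain ⟨a, rfl⟩ := H.surjective p
    rw [H.apply_sub, hf₁, hf₂]
    rfl
  · exact (hker (Or.inr h)).elim
  · have hR : ∀ p, R p = (0, -p.2) := fun p => by
      obtain ⟨a, rfl⟩ := H.surjective p
      rw [H.apply_sub, hf₁, hf₂, hh₂, zero_sub, neg_neg]
    refine Or.inr (Or.inl (Or.inr (Or.inr ⟨LinearEquiv.refl K S, fun _ _ => rfl,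
      Or.inr (Or.inr fun p => ?_)⟩)))
    exact congrArg Prod.swap (hR p.swap)
  · refine Or.inl (Or.inr (Or.inr ⟨α.symm.trans γ, isAut_trans (isAut_symm hα) hγ,
      Or.inr (Or.inl fun p => ?_)⟩))
    obtain ⟨a, rfl⟩ := H.surjective p
    rw [H.apply_sub, hf₁, hh₁, hf₂, sub_zero, LinearEquiv.trans_apply, α.symm_apply_apply]
  · refine Or.inr (Or.inr (Or.inl (Or.inr (Or.inr ⟨α.symm.trans δ,
      isAut_trans (isAut_symm hα) hδ, Or.inl fun p => ?_⟩))))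
    obtain ⟨a, rfl⟩ := H.surjective p
    rw [LinearMap.sub_apply, LinearMap.neg_apply, H.apply_sub, hf₁, hh₁, hf₂, hh₂, sub_zero,
      LinearEquiv.trans_apply, α.symm_apply_apply, LinearMap.id_apply]
    ext
    · simp
    · change -γ a.2 - (δ a.1 - γ a.2) = -δ a.1
      abel

theorem Shape.comp_swap {f h : S × S → S} (H : Shape K sb f h) :
    Shape K sb (f ∘ Prod.swap) (h ∘ Prod.swap) := by
  rcases H with ⟨a, b⟩ | ⟨a, b⟩ | ⟨a, b⟩ | ⟨a, b⟩ | ⟨a, b⟩ | ⟨a, b⟩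
  · exact Or.inr (Or.inl ⟨fun x => a x.swap, b.comp_swap⟩)
  · exact Or.inl ⟨fun x => a x.swap, b.comp_swap⟩
  · exact Or.inr (Or.inr (Or.inr (Or.inl ⟨a.comp_swap, fun x => b x.swap⟩)))
  · exact Or.inr (Or.inr (Or.inl ⟨a.comp_swap, fun x => b x.swap⟩))
  · exact Or.inr (Or.inr (Or.inr (Or.inr (Or.inr ⟨a.comp_swap, b.comp_swap⟩))))
  · exact Or.inr (Or.inr (Or.inr (Or.inr (Or.inl ⟨a.comp_swap, b.comp_swap⟩))))

theorem Shape.symm {f h : S × S → S} (H : Shape K sb f h) : Shape K sb h f := by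
  unfold Shape at H ⊢
  tauto

theorem isSpecial_of_zero [CharZero K] (H : IsParametrised R f₁ h₁ f₂ h₂)
    (hsimple : IsSimpleBr K sb)
    (hf₁ : ∀ a, f₁ a = 0) (hh₁ : IsAutFst K sb h₁ ∨ IsAutSnd K sb h₁) (h₂' : Shape K sb f₂ h₂) :
    IsSpecialUpToSymm K sb R := by
  rcases hh₁ with hh₁ | hh₁
  · exact H.isSpecial_of_zero_autFst hsimple hf₁ hh₁ h₂'
  · exact H.comp_swap.isSpecial_of_zero_autFst hsimple (fun a => hf₁ a.swap) hh₁.comp_swap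
      h₂'.comp_swap

theorem isSpecial_or_mixed [CharZero K] (H : IsParametrised R f₁ h₁ f₂ h₂)
    (hsimple : IsSimpleBr K sb)
    (h₁' : Shape K sb f₁ h₁) (h₂' : Shape K sb f₂ h₂) : IsSpecialUpToSymm K sb R ∨
      (IsAutFst K sb f₁ ∧ IsAutSnd K sb h₁) ∨ (IsAutSnd K sb f₁ ∧ IsAutFst K sb h₁) := by
  rcases h₁' with ⟨a, b⟩ | ⟨a, b⟩ | ⟨a, b⟩ | ⟨a, b⟩ | h
  · exact Or.inl (H.isSpecial_of_zero hsimple a (Or.inl b) h₂')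
  · exact Or.inl (H.isSpecial_of_zero hsimple a (Or.inr b) h₂')
  · exact Or.inl (H.neg_sub_id.isSpecial_of_zero hsimple b (Or.inl a) h₂'.symm).of_neg_sub_id
  · exact Or.inl (H.neg_sub_id.isSpecial_of_zero hsimple b (Or.inr a) h₂'.symm).of_neg_sub_id
  · exact Or.inr h

theorem isSpecial [CharZero K] [FiniteDimensional K S] (H : IsParametrised R f₁ h₁ f₂ h₂)
    (hsb : IsLieBr K sb)
    (hsimple : IsSimpleBr K sb) (h₁' : Shape K sb f₁ h₁) (h₂' : Shape K sb f₂ h₂) :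
    IsSpecialUpToSymm K sb R := by
  obtain h | H₁ := H.isSpecial_or_mixed hsimple h₁' h₂'
  · exact h
  obtain h | H₂ := H.swap.isSpecial_or_mixed hsimple h₂' h₁'
  · exact h.of_swap
  suffices ∃ a b, a ≠ 0 ∧ h₁ (a, b) = f₁ (a, b) ∧ h₂ (a, b) = f₂ (a, b) by
    obtain ⟨a, b, ha, h, h'⟩ := this
    exact absurd (congrArg Prod.fst (H.injective (a, b) h h')) ha
  rcases H₁ with ⟨⟨α, hα, e₁⟩, β, hβ, e₂⟩ | ⟨⟨β, hβ, e₂⟩, α, hα, e₁⟩ <;>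
  rcases H₂ with ⟨⟨γ, hγ, e₃⟩, δ, hδ, e₄⟩ | ⟨⟨δ, hδ, e₄⟩, γ, hγ, e₃⟩ <;>
  obtain ⟨a, b, ha, h, h'⟩ := hsb.exists_simultaneous_eq hsimple hα hβ hγ hδ <;>
  refine ⟨a, b, ha, ?_, ?_⟩ <;> simp only [e₁, e₂, e₃, e₄, h, h']

end IsParametrised

end

theorem rb_on_simple_plus_simple (K : Type*) {S : Type*} [Field K] [CharZero K]
    [AddCommGroup S] [Module K S] [FiniteDimensional K S]
    (sb : S → S → S) (hsb : IsLieBr K sb) (hsimple : IsSimpleBr K sb)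
    (R : (S × S) →ₗ[K] (S × S))
    (hR : IsLieRB K (fun x y : S × S => (sb x.1 y.1, sb x.2 y.2)) R 1)
    (hiso : LieBrIso K (indBr (fun x y : S × S => (sb x.1 y.1, sb x.2 y.2)) R)
      (fun x y : S × S => (sb x.1 y.1, sb x.2 y.2))) :
    IsSpecialRBForm K sb R ∨
    IsSpecialRBForm K sb
      ((LinearEquiv.prodComm K S S).toLinearMap ∘ₗ R ∘ₗ (LinearEquiv.prodComm K S S).toLinearMap) ∨
    IsSpecialRBForm K sb (-R - LinearMap.id) ∨
    IsSpecialRBForm K sb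
      ((LinearEquiv.prodComm K S S).toLinearMap ∘ₗ (-R - LinearMap.id) ∘ₗ
        (LinearEquiv.prodComm K S S).toLinearMap) := by
  obtain ⟨e, he⟩ := hiso
  have hskew : ∀ x y, sb x y = -sb y x := fun x y => by
    have h := hsb.2.2.1 (x + y)
    rw [(hsb.1 _).map_add, (hsb.2.1 x).map_add, (hsb.2.1 y).map_add, hsb.2.2.1, hsb.2.2.1,
      zero_add, add_zero] at h
    rw [eq_neg_iff_add_eq_zero, add_comm, h]
  let b : S × S → S × S → S × S := fun x y => (sb x.1 y.1, sb x.2 y.2)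
  have hb : ∀ x y, b x y = -b y x := fun x y => Prod.ext (hskew _ _) (hskew _ _)
  have hbl : ∀ x x' y, b (x + x') y = b x y + b x' y := fun x x' y =>
    Prod.ext ((hsb.2.1 _).map_add _ _) ((hsb.2.1 _).map_add _ _)
  have hbr : ∀ x y y', b x (y + y') = b x y + b x y' := fun x y y' =>
    Prod.ext ((hsb.1 _).map_add _ _) ((hsb.1 _).map_add _ _)
  have hR' : ∀ x y, R (indBr b R x y) = b (R x) (R y) := fun x y => by
    have h : b (R x) (R y) = R (b (R x) y + b x (R y) + (1 : K) • b x y) := hR x y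
    rw [h, one_smul, hb x (R y), ← sub_eq_add_neg]
    rfl
  have he' : ∀ x y, e.symm (b x y) = indBr b R (e.symm x) (e.symm y) := fun x y => by
    rw [LinearEquiv.symm_apply_eq]
    refine Eq.trans ?_ (he _ _).symm
    rw [e.apply_symm_apply, e.apply_symm_apply]
  let u : S × S →ₗ[K] S × S := R ∘ₗ e.symm.toLinearMap
  let v : S × S →ₗ[K] S × S := u + e.symm.toLinearMap
  have hu : ∀ x y, u (b x y) = b (u x) (u y) := fun x y => by
    change R (e.symm (b x y)) = _
    rw [he', hR']
    rfl
  have hv : ∀ x y, v (b x y) = b (v x) (v y) := fun x y => by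
    change u (b x y) + e.symm (b x y) = b (u x + e.symm x) (u y + e.symm y)
    rw [hu, he', hbl, hbr, hbr, hb (e.symm x) (u y)]
    change _ + (b (u x) (e.symm y) - b (u y) (e.symm x) + b (e.symm x) (e.symm y)) = _
    abel
  have hsub : ∀ a, ((v a).1 - (u a).1, (v a).2 - (u a).2) = e.symm a := fun a =>
    Prod.ext (add_sub_cancel_left (u a).1 (e.symm a).1) (add_sub_cancel_left (u a).2 (e.symm a).2)
  have H : IsParametrised R (LinearMap.fst K S S ∘ₗ u) (LinearMap.fst K S S ∘ₗ v)
      (LinearMap.snd K S S ∘ₗ u) (LinearMap.snd K S S ∘ₗ v) :=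
    { injective := fun a h h' => by
        rw [← e.symm.map_eq_zero_iff, ← hsub]
        exact Prod.ext (sub_eq_zero.mpr h) (sub_eq_zero.mpr h')
      surjective := fun p => ⟨e p, (hsub _).trans (e.symm_apply_apply p)⟩
      apply_sub := fun a => congrArg R (hsub a) }
  exact H.isSpecial hsb hsimple
    (IsParametrised.shape hsb hsimple (fun x y => congrArg Prod.fst (hu x y))
      (fun x y => congrArg Prod.fst (hv x y)) H.surjective_fst)
    (IsParametrised.shape hsb hsimple (fun x y => congrArg Prod.snd (hu x y))
      (fun x y => congrArg Prod.snd (hv x y)) H.swap.surjective_fst)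
end

section
/- Let g = (V, [·,·]) and n = (V, {·,·}) be finite-dimensional Lie algebra structures on the same complex vector space V, where g is semisimple and n is complete, and suppose there exists a post-Lie algebra structure x·y on the pair (g, n). Then n is semisimple. -/
/-- A derivation of the Lie algebra `(V, b)`. -/
def IsLieDer (K : Type*) {V : Type*} [Field K] [CharZero K] [AddCommGroup V] [Module K V]
    (b : V → V → V) (D : V →ₗ[K] V) : Prop :=
  ∀ x y : V, D (b x y) = b (D x) y + b x (D y)

/-- A Lie algebra `(V, b)` is complete if it has trivial center and every
derivation is inner. -/
def IsCompleteLie (K : Type*) {V : Type*} [Field K] [CharZero K] [AddCommGroup V] [Module K V]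
    (b : V → V → V) : Prop :=
  (∀ x : V, (∀ y : V, b x y = 0) → x = 0) ∧
  ∀ D : V →ₗ[K] V, IsLieDer K b D → ∃ z : V, ∀ x : V, D x = b z x

/-- The derived series of the subspace `I` inside the Lie algebra `(V, b)`. -/
def derSeriesFrom (K : Type*) {V : Type*} [Field K] [CharZero K] [AddCommGroup V] [Module K V]
    (b : V → V → V) (I : Submodule K V) : ℕ → Submodule K V
  | 0 => I
  | n + 1 => Submodule.span K
      {z | ∃ x ∈ derSeriesFrom K b I n, ∃ y ∈ derSeriesFrom K b I n, z = b x y}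

/-- The Lie algebra `(V, b)` is semisimple: its only solvable ideal is zero. -/
def IsSemisimpleBr (K : Type*) {V : Type*} [Field K] [CharZero K] [AddCommGroup V] [Module K V]
    (b : V → V → V) : Prop :=
  ∀ I : Submodule K V, IsLieIdeal K b I → (∃ n : ℕ, derSeriesFrom K b I n = ⊥) → I = ⊥

section Weyl

open LieModule LieAlgebra

attribute [local instance] LieRing.ofAssociativeRing

variable {K L M : Type*} [Field K] [LieRing L] [LieAlgebra K L] [Module.Finite K L]
  [AddCommGroup M] [Module K M]

lemma killing_derivedSeries_one_eq_top [IsKilling K L] : derivedSeries K L 1 = ⊤ := by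
  have h : LieIdeal.killingCompl K L (derivedSeries K L 1) = ⊥ := by
    rw [LieSubmodule.eq_bot_iff]
    intro x hx
    rw [LieIdeal.mem_killingCompl] at hx
    have hc : x ∈ center K L := by
      rw [mem_maxTrivSubmodule]
      intro y
      have hk : ⁅y, x⁆ ∈ LinearMap.ker (killingForm K L) := by
        rw [LinearMap.mem_ker]
        ext z
        have h1 : ⁅z, y⁆ ∈ derivedSeries K L 1 :=
          LieSubmodule.lie_mem_lie (LieSubmodule.mem_top z) (LieSubmodule.mem_top y)
        have h2 := hx _ h1
        rw [traceForm_apply_lie_apply] at h2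
        rw [traceForm_comm, h2, LinearMap.zero_apply]
      simpa using hk
    simpa using hc
  have h' := (LieIdeal.isCompl_killingCompl (derivedSeries K L 1)).sup_eq_top
  rwa [h, sup_bot_eq] at h'

lemma killing_linearMap_eq_zero [IsKilling K L] {f : L →ₗ[K] M} (hf : ∀ x y : L, f ⁅x, y⁆ = 0) :
    f = 0 := by
  have h : (derivedSeries K L 1).toSubmodule ≤ LinearMap.ker f := by
    refine (coe_derivedSeries_one_eq K L).trans_le ?_
    rw [Submodule.span_le]
    rintro _ ⟨x, y, rfl⟩
    exact hf x y
  rw [killing_derivedSeries_one_eq_top] at h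
  ext x
  exact h (LieSubmodule.mem_top x)

lemma killing_trace_eq_zero [IsKilling K L] (ρ : L →ₗ⁅K⁆ Module.End K M) (x : L) :
    LinearMap.trace K M (ρ x) = 0 := by
  have h : (LinearMap.trace K M ∘ₗ (ρ : L →ₗ[K] Module.End K M)) = 0 :=
    killing_linearMap_eq_zero fun x y => by simp
  exact LinearMap.congr_fun h x

section LieModule

variable [LieRingModule L M] [LieModule K L M]

lemma isTrivial_of_killing_of_isNilpotent [IsKilling K L] [LieModule.IsNilpotent L M] :
    IsTrivial L M := by
  have h (k : ℕ) (x : L) (m : M) : ⁅x, m⁆ ∈ lowerCentralSeries K L M (k + 1) := by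
    induction k generalizing x m with
    | zero =>
      rw [lowerCentralSeries_succ]
      exact LieSubmodule.lie_mem_lie (LieSubmodule.mem_top x) (LieSubmodule.mem_top m)
    | succ k ih =>
      let f : L →ₗ[K] M ⧸ (lowerCentralSeries K L M (k + 2)).toSubmodule :=
        (Submodule.mkQ _) ∘ₗ ((toEnd K L M : L →ₗ[K] Module.End K M).flip m)
      have hf : f = 0 := killing_linearMap_eq_zero fun y z => by
        have key : ⁅⁅y, z⁆, m⁆ ∈ lowerCentralSeries K L M (k + 2) := by
          rw [lie_lie, lowerCentralSeries_succ]
          exact sub_mem (LieSubmodule.lie_mem_lie (LieSubmodule.mem_top y) (ih z m))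
            (LieSubmodule.lie_mem_lie (LieSubmodule.mem_top z) (ih y m))
        exact (Submodule.Quotient.mk_eq_zero _).mpr key
      simpa [f, Submodule.Quotient.mk_eq_zero] using LinearMap.congr_fun hf x
  obtain ⟨k, hk⟩ := LieModule.IsNilpotent.nilpotent K L M
  refine ⟨fun x m => ?_⟩
  have := antitone_lowerCentralSeries K L M (Nat.le_succ k) (h k x m)
  simpa [hk] using this

lemma isTrivial_of_traceForm_eq_zero [Module.Finite K M] [CharZero K] [IsKilling K L]
    (h : traceForm K L M = 0) : IsTrivial L M := by
  have h1 := isNilpotent_derivedSeries_of_traceForm_eq_zero h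
  rw [isNilpotent_iff_forall' (R := K)] at h1
  have : LieModule.IsNilpotent L M := by
    rw [isNilpotent_iff_forall' (R := K)]
    intro x
    exact h1 ⟨x, by rw [killing_derivedSeries_one_eq_top]; exact LieSubmodule.mem_top x⟩
  exact isTrivial_of_killing_of_isNilpotent (K := K)

/-- A Casimir element of a representation with nonzero trace form. -/
lemma exists_casimir [CharZero K] [IsKilling K L] (h : traceForm K L M ≠ 0) :
    ∃ C : Module.End K M, (∀ (x : L) (m : M), C ⁅x, m⁆ = ⁅x, C m⁆) ∧
      LinearMap.trace K M C ≠ 0 ∧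
      ∀ χ : M →ₗ[K] K, (∀ (x : L) (m : M), χ ⁅x, m⁆ = 0) → χ ∘ₗ C = 0 := by
  classical
  let I : LieIdeal K L :=
    { LinearMap.ker (traceForm K L M) with
      lie_mem := by
        intro x m hm
        have hm' : traceForm K L M m = 0 := hm
        change traceForm K L M ⁅x, m⁆ = 0
        ext z
        rw [traceForm_apply_lie_apply', hm']
        simp }
  have memI (x : L) : x ∈ I ↔ traceForm K L M x = 0 := Iff.rfl
  let J := LieIdeal.killingCompl K L I
  have hIJ : IsCompl I J := LieIdeal.isCompl_killingCompl I
  have hsplit (z : L) : ∃ i ∈ I, ∃ j ∈ J, i + j = z := by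
    have : z ∈ I ⊔ J := by rw [hIJ.sup_eq_top]; exact LieSubmodule.mem_top z
    simpa [LieSubmodule.mem_sup] using this
  let B : LinearMap.BilinForm K J := LinearMap.BilinForm.restrict (traceForm K L M) J.toSubmodule
  have hB (x y : J) : B x y = traceForm K L M x y := rfl
  have hker (x : J) (hx : ∀ y, B x y = 0) : x = 0 := by
    have : (x : L) ∈ I ⊓ J := by
      refine ⟨?_, x.2⟩
      change (x : L) ∈ I
      rw [memI]
      ext z
      obtain ⟨i, hi, j, hj, rfl⟩ := hsplit z
      rw [memI] at hi
      rw [map_add, traceForm_comm K L M x i, hi]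
      rw [LinearMap.zero_apply, zero_add]
      exact hx ⟨j, hj⟩
    rw [hIJ.inf_eq_bot] at this
    simpa using this
  have hnd : B.Nondegenerate := by
    refine ⟨hker, fun y hy => hker y fun x => ?_⟩
    rw [hB, traceForm_comm, ← hB, hy]
  let b := Module.finBasis K J
  let d := B.dualBasis hnd b
  have hdb := LinearMap.BilinForm.apply_dualBasis_left hnd b
  have lie_b (x : L) (i) : ⁅x, b i⁆ = ∑ j, B (d j) ⁅x, b i⁆ • b j := by
    conv_lhs => rw [← b.sum_repr ⁅x, b i⁆]
    refine Finset.sum_congr rfl fun j _ => ?_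
    congr 1
    conv_rhs => rw [← b.sum_repr ⁅x, b i⁆]
    rw [map_sum, Finset.sum_eq_single j] <;> simp +contextual [d, hdb]
  have lie_d (x : L) (i) : ⁅x, d i⁆ = ∑ j, B ⁅x, d i⁆ (b j) • d j := by
    conv_lhs => rw [← d.sum_repr ⁅x, d i⁆]
    simp [d]
  have hinv (x : L) (i j) : B ⁅x, d i⁆ (b j) = - B (d i) ⁅x, b j⁆ := by
    simp [hB, traceForm_apply_lie_apply']
  let φ : J → Module.End K M := fun y => toEnd K L M (y : L)
  let C : Module.End K M := ∑ i, φ (d i) * φ (b i)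
  have hC (m : M) : C m = ∑ i, ⁅(d i : L), ⁅(b i : L), m⁆⁆ := by
    simp [C, φ]
  refine ⟨C, fun x m => ?_, ?_, fun χ hχ => ?_⟩
  · have h1 (i) : ⁅x, ⁅(d i : L), ⁅(b i : L), m⁆⁆⁆ = ⁅(d i : L), ⁅(b i : L), ⁅x, m⁆⁆⁆
        + (⁅((⁅x, d i⁆ : J) : L), ⁅(b i : L), m⁆⁆ + ⁅(d i : L), ⁅((⁅x, b i⁆ : J) : L), m⁆⁆) := by
      simp only [LieSubmodule.coe_bracket, lie_lie, lie_sub]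
      abel
    have h2 : ∑ i, (⁅((⁅x, d i⁆ : J) : L), ⁅(b i : L), m⁆⁆
        + ⁅(d i : L), ⁅((⁅x, b i⁆ : J) : L), m⁆⁆) = 0 := by
      rw [Finset.sum_add_distrib]
      have e1 (i) : ⁅((⁅x, d i⁆ : J) : L), ⁅(b i : L), m⁆⁆
          = ∑ j, B ⁅x, d i⁆ (b j) • ⁅(d j : L), ⁅(b i : L), m⁆⁆ := by
        conv_lhs => rw [lie_d x i]
        simp [sum_lie]
      have e2 (i) : ⁅(d i : L), ⁅((⁅x, b i⁆ : J) : L), m⁆⁆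
          = ∑ j, B (d j) ⁅x, b i⁆ • ⁅(d i : L), ⁅(b j : L), m⁆⁆ := by
        conv_lhs => rw [lie_b x i]
        simp [sum_lie, lie_sum]
      simp only [e1, e2]
      rw [Finset.sum_comm, ← Finset.sum_add_distrib]
      refine Finset.sum_eq_zero fun i _ => ?_
      rw [← Finset.sum_add_distrib]
      refine Finset.sum_eq_zero fun j _ => ?_
      rw [hinv]
      simp
    rw [hC, hC, lie_sum]
    simp only [h1]
    rw [Finset.sum_add_distrib, h2, add_zero]
  · have h1 : LinearMap.trace K M C = Module.finrank K J := by
      have h2 (i) : LinearMap.trace K M (φ (d i) * φ (b i)) = 1 := by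
        have := hdb i i
        simpa [hB, traceForm_apply_apply, φ] using! this
      simp [C, h2]
    rw [h1]
    intro h0
    have h0' : Module.finrank K J = 0 := by exact_mod_cast h0
    rw [Module.finrank_zero_iff] at h0'
    apply h
    ext x y
    obtain ⟨i, hi, j, hj, rfl⟩ := hsplit x
    have : (⟨j, hj⟩ : J) = 0 := Subsingleton.elim _ _
    have hj0 : j = 0 := congrArg Subtype.val this
    rw [memI] at hi
    simp [hj0, hi]
  · ext m
    simp [hC, hχ]

/-- An invariant linear functional that does not vanish identically takes the value `1` at some
invariant vector. -/
theorem exists_invariant_of_functional [Module.Finite K M] [CharZero K] [IsKilling K L]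
    (χ : M →ₗ[K] K)
    (hχ : ∀ (x : L) (m : M), χ ⁅x, m⁆ = 0) (h0 : χ ≠ 0) :
    ∃ m : M, (∀ x : L, ⁅x, m⁆ = 0) ∧ χ m = 1 := by
  induction hn : Module.finrank K M using Nat.strong_induction_on generalizing M with
  | _ n ih =>
  by_cases htf : traceForm K L M = 0
  · have := isTrivial_of_traceForm_eq_zero htf
    obtain ⟨m, hm⟩ := LinearMap.surjective h0 1
    exact ⟨m, fun x => trivial_lie_zero L M x m, hm⟩
  · obtain ⟨C, hC, htr, hχC⟩ := exists_casimir htf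
    obtain ⟨k, hk0, hk⟩ := ((Filter.eventually_ge_atTop 1).and
      (LinearMap.eventually_isCompl_ker_pow_range_pow C)).exists
    have hCk (x : L) (m : M) : (C ^ k) ⁅x, m⁆ = ⁅x, (C ^ k) m⁆ := by
      clear hk hk0
      induction k with
      | zero => simp
      | succ k ihk => simp [pow_succ', ihk, hC]
    let N : LieSubmodule K L M :=
      { LinearMap.ker (C ^ k) with
        lie_mem := by
          intro x m hm
          have hm' : (C ^ k) m = 0 := hm
          change (C ^ k) ⁅x, m⁆ = 0
          rw [hCk, hm', lie_zero] }
    have hχk : ∀ m, χ ((C ^ k) m) = 0 := by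
      intro m
      obtain ⟨j, rfl⟩ := Nat.exists_eq_add_of_le' hk0
      rw [pow_succ']
      exact LinearMap.congr_fun (hχC χ hχ) _
    have hN : Module.finrank K N < n := by
      rw [← hn]
      refine Submodule.finrank_lt fun htop => htr ?_
      have hCk0 : C ^ k = 0 := LinearMap.ker_eq_top.mp htop
      exact (LinearMap.isNilpotent_trace_of_isNilpotent ⟨k, hCk0⟩).eq_zero
    have hχN : χ ∘ₗ N.toSubmodule.subtype ≠ 0 := by
      intro h
      apply h0
      ext m
      have hm : m ∈ LinearMap.ker (C ^ k) ⊔ LinearMap.range (C ^ k) := by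
        rw [hk.sup_eq_top]; trivial
      obtain ⟨u, hu, _, ⟨v, rfl⟩, rfl⟩ := Submodule.mem_sup.mp hm
      have hu' : χ u = 0 := LinearMap.congr_fun h ⟨u, hu⟩
      simp [hu', hχk]
    obtain ⟨m, hm, hm1⟩ := ih _ hN (M := N) (χ ∘ₗ N.toSubmodule.subtype)
      (fun x m => hχ x m) hχN rfl
    exact ⟨m, fun x => congrArg Subtype.val (hm x), hm1⟩

/-- Weyl's theorem: a submodule is the image of an equivariant projection. -/
theorem exists_equivariant_projection [Module.Finite K M] [CharZero K] [IsKilling K L]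
    (N : LieSubmodule K L M) :
    ∃ p : Module.End K M, (∀ m, p m ∈ N) ∧ (∀ m ∈ N, p m = m) ∧
      ∀ (x : L) (m : M), p ⁅x, m⁆ = ⁅x, p m⁆ := by
  by_cases hN : ∃ n₀ ∈ N, n₀ ≠ 0
  swap
  · push Not at hN
    exact ⟨0, fun m => N.zero_mem, fun m hm => (hN m hm).symm, by simp⟩
  obtain ⟨n₀, hn₀, hne⟩ := hN
  obtain ⟨f, hf⟩ := Module.Projective.exists_dual_eq_one K hne
  let W : LieSubmodule K L (M →ₗ[K] M) :=
    { carrier := {F | (∀ m, F m ∈ N) ∧ ∃ c : K, ∀ m ∈ N, F m = c • m}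
      add_mem' := by
        rintro F G ⟨hF, c, hc⟩ ⟨hG, d, hd⟩
        exact ⟨fun m => N.add_mem (hF m) (hG m), c + d, fun m hm => by
          simp [hc m hm, hd m hm, add_smul]⟩
      zero_mem' := ⟨fun m => N.zero_mem, 0, by simp⟩
      smul_mem' := by
        rintro a F ⟨hF, c, hc⟩
        exact ⟨fun m => N.smul_mem a (hF m), a * c, fun m hm => by simp [hc m hm, mul_smul]⟩
      lie_mem := by
        rintro x F ⟨hF, c, hc⟩
        refine ⟨fun m => ?_, 0, fun m hm => ?_⟩
        · rw [LieHom.lie_apply]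
          exact sub_mem (N.lie_mem (hF m)) (hF _)
        · rw [LieHom.lie_apply, hc m hm, hc _ (N.lie_mem hm)]
          simp }
  have hW (F : W) : (∀ m, F.1 m ∈ N) ∧ ∃ c : K, ∀ m ∈ N, F.1 m = c • m := F.2
  let χ : W →ₗ[K] K :=
    { toFun := fun F => f (F.1 n₀)
      map_add' := fun F G => by simp
      map_smul' := fun a F => by simp }
  obtain ⟨P, hP⟩ := N.toSubmodule.exists_isCompl
  let q : M →ₗ[K] M := N.toSubmodule.subtype ∘ₗ N.toSubmodule.projectionOnto P hP
  have hq : q ∈ W := ⟨fun m => (N.toSubmodule.projectionOnto P hP m).2, 1, fun m hm => by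
    have := Submodule.projectionOnto_apply_left hP ⟨m, hm⟩
    simpa [q] using congrArg Subtype.val this⟩
  obtain ⟨F, hF, hF1⟩ := exists_invariant_of_functional (L := L) χ
    (fun x F => by
      obtain ⟨-, c, hc⟩ := hW F
      change f ((⁅x, F.1⁆ : M →ₗ[K] M) n₀) = 0
      rw [LieHom.lie_apply, hc _ hn₀, hc _ (N.lie_mem hn₀)]
      simp)
    (fun h => by
      have h1 : f (q n₀) = 0 := LinearMap.congr_fun h ⟨q, hq⟩
      have h2 := Submodule.projectionOnto_apply_left hP ⟨n₀, hn₀⟩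
      have h3 : q n₀ = n₀ := congrArg Subtype.val h2
      rw [h3, hf] at h1
      exact one_ne_zero h1)
  obtain ⟨hFN, c, hc⟩ := hW F
  have hc1 : c = 1 := by
    have h1 : f (F.1 n₀) = 1 := hF1
    simpa [hc _ hn₀, hf] using h1
  refine ⟨F.1, hFN, fun m hm => by simp [hc m hm, hc1], fun x m => ?_⟩
  have h1 : (⁅x, F.1⁆ : M →ₗ[K] M) = 0 := congrArg Subtype.val (hF x)
  have h2 := LinearMap.congr_fun h1 m
  rw [LieHom.lie_apply, LinearMap.zero_apply, sub_eq_zero] at h2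
  exact h2.symm

end LieModule

/-- Weyl's theorem, for a representation given as a Lie algebra homomorphism. -/
theorem exists_projection_of_representation [Module.Finite K M] [CharZero K] [IsKilling K L]
    (ρ : L →ₗ⁅K⁆ Module.End K M) (N : Submodule K M) (hN : ∀ x, ∀ m ∈ N, ρ x m ∈ N) :
    ∃ p : Module.End K M, (∀ m, p m ∈ N) ∧ (∀ m ∈ N, p m = m) ∧
      ∀ (x : L) (m : M), p (ρ x m) = ρ x (p m) := by
  let : LieRingModule (Module.End K M) M := LieRingModule.ofAssociativeModule
  have : LieModule K (Module.End K M) M := LieModule.ofAssociativeModule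
  let := LieRingModule.compLieHom M ρ
  have := LieModule.compLieHom M ρ
  exact exists_equivariant_projection (L := L) { N with lie_mem := fun {x m} hm => hN x m hm }

end Weyl

section PostLie

open LieAlgebra

attribute [local instance] LieRing.ofAssociativeRing

section Bracket

variable {K V : Type*} [Field K] [CharZero K] [AddCommGroup V] [Module K V] {b : V → V → V}

lemma IsLieBr.skew (h : IsLieBr K b) (x y : V) : b x y = - b y x := by
  have h1 := h.2.2.1 (x + y)
  rw [(h.1 _).map_add, (h.2.1 x).map_add, (h.2.1 y).map_add, h.2.2.1 x, h.2.2.1 y] at h1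
  rw [eq_neg_iff_add_eq_zero]
  simpa [add_comm] using h1

/-- The Lie ring with underlying group `V` and bracket `b`. -/
abbrev IsLieBr.lieRing (h : IsLieBr K b) : LieRing V where
  bracket := b
  add_lie x y z := (h.2.1 z).map_add x y
  lie_add x y z := (h.1 x).map_add y z
  lie_self := h.2.2.1
  leibniz_lie := h.2.2.2

/-- The Lie algebra with underlying vector space `V` and bracket `b`. -/
abbrev IsLieBr.lieAlgebra (h : IsLieBr K b) : @LieAlgebra K V _ h.lieRing :=
  letI := h.lieRing
  { (inferInstance : Module K V) with lie_smul := fun t x y => (h.1 x).map_smul t y }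

/-- The adjoint representation of the bracket `b`, as a linear map. -/
def IsLieBr.adj (h : IsLieBr K b) : V →ₗ[K] Module.End K V :=
  LinearMap.mk₂ K b (fun x y z => (h.2.1 z).map_add x y) (fun c x y => (h.2.1 y).map_smul c x)
    (fun x y z => (h.1 x).map_add y z) (fun c x y => (h.1 x).map_smul c y)

@[simp] lemma IsLieBr.adj_apply (h : IsLieBr K b) (x y : V) : h.adj x y = b x y := rfl

lemma IsLieBr.adj_bracket (h : IsLieBr K b) (x y : V) : h.adj (b x y) = ⁅h.adj x, h.adj y⁆ := by
  ext z
  simp [Ring.lie_def, h.2.2.2 x y z]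

lemma IsSemisimpleBr.isKilling [FiniteDimensional K V] (h : IsLieBr K b)
    (hss : IsSemisimpleBr K b) : @IsKilling K V _ h.lieRing h.lieAlgebra := by
  let := h.lieRing
  let := h.lieAlgebra
  have : HasTrivialRadical K V := by
    rw [hasTrivialRadical_iff_no_abelian_ideals]
    intro I hI
    have h0 : I.toSubmodule = ⊥ := by
      refine hss I.toSubmodule (fun x y hy => I.lie_mem hy) ⟨1, ?_⟩
      change Submodule.span K _ = ⊥
      rw [Submodule.span_eq_bot]
      rintro _ ⟨x, hx, y, hy, rfl⟩
      exact congrArg Subtype.val (hI.trivial ⟨x, hx⟩ ⟨y, hy⟩)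
    simpa using h0
  infer_instance

lemma IsLieBr.isLieIdeal_derSeriesFrom (h : IsLieBr K b) {I : Submodule K V}
    (hI : IsLieIdeal K b I) (n : ℕ) : IsLieIdeal K b (derSeriesFrom K b I n) := by
  induction n with
  | zero => exact hI
  | succ n ih =>
    intro x y hy
    change y ∈ Submodule.span K _ at hy
    change b x y ∈ Submodule.span K _
    induction hy using Submodule.span_induction with
    | mem z hz =>
      obtain ⟨u, hu, v, hv, rfl⟩ := hz
      rw [h.2.2.2]
      exact add_mem (Submodule.subset_span ⟨_, ih x u hu, v, hv, rfl⟩)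
        (Submodule.subset_span ⟨u, hu, _, ih x v hv, rfl⟩)
    | zero => rw [(h.1 x).map_zero]; exact zero_mem _
    | add u v _ _ hu hv => rw [(h.1 x).map_add]; exact add_mem hu hv
    | smul c u _ hu => rw [(h.1 x).map_smul]; exact Submodule.smul_mem _ _ hu

/-- A Lie algebra without nonzero abelian ideals is semisimple. -/
lemma IsLieBr.isSemisimpleBr_of_abelian_ideals (h : IsLieBr K b)
    (hab : ∀ A : Submodule K V, IsLieIdeal K b A → (∀ x ∈ A, ∀ y ∈ A, b x y = 0) → A = ⊥) :
    IsSemisimpleBr K b := by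
  rintro I hI ⟨n, hn⟩
  induction n with
  | zero => exact hn
  | succ n ih =>
    refine ih (hab _ (h.isLieIdeal_derSeriesFrom hI n) fun x hx y hy => ?_)
    have h1 : b x y ∈ derSeriesFrom K b I (n + 1) := Submodule.subset_span ⟨x, hx, y, hy, rfl⟩
    simpa [hn] using h1

/-- Post-Lie structures on a complete Lie algebra come from Rota–Baxter operators of weight one. -/
lemma IsPostLie.exists_operator {gb nb mul : V → V → V} (hn : IsLieBr K nb)
    (hc : IsCompleteLie K nb) (hpl : IsPostLie K gb nb mul) :
    ∃ R : V →ₗ[K] V, (∀ x y, nb (R x) (R y) = R (gb x y)) ∧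
      ∀ x y, gb x y = nb (R x) y + nb x (R y) + nb x y := by
  obtain ⟨hl, hr, h1, h2, h3⟩ := hpl
  have key (x : V) : ∃ z, ∀ y, mul x y = nb z y := hc.2 (hl x).mk' (h3 x)
  choose R hR using key
  have inj {u v : V} (h : ∀ y, nb u y = nb v y) : u = v :=
    sub_eq_zero.mp (hc.1 _ fun y => by rw [(hn.2.1 y).map_sub, h, sub_self])
  refine ⟨{ toFun := R, map_add' := fun x y => inj fun z => ?_,
            map_smul' := fun c x => inj fun z => ?_ }, fun x y => inj fun z => ?_, fun x y => ?_⟩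
  · rw [← hR, (hr z).map_add, (hn.2.1 z).map_add, hR, hR]
  · rw [← hR, (hr z).map_smul, RingHom.id_apply, (hn.2.1 z).map_smul, hR]
  · change nb (nb (R x) (R y)) z = nb (R (gb x y)) z
    rw [← hR (gb x y), h2, hR y, hR x, hR x, hR y, hn.2.2.2 (R x)]
    abel
  · have := h1 x y
    rw [hR, hR, hn.skew (R y)] at this
    change gb x y = nb (R x) y + nb x (R y) + nb x y
    rw [← sub_eq_iff_eq_add, ← this]
    abel

end Bracket

variable {K V : Type*} [Field K] [CharZero K] [AddCommGroup V] [Module K V]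
  [FiniteDimensional K V]

/-- If a weight-one Rota–Baxter operator on a centerless `nb` induces a semisimple bracket, then
`nb` has no nonzero abelian ideals. -/
lemma abelian_ideal_eq_bot_of_operator {gb nb : V → V → V} (hg : IsLieBr K gb)
    (hn : IsLieBr K nb) (hgss : IsSemisimpleBr K gb) (hz : ∀ x, (∀ y, nb x y = 0) → x = 0)
    (R : V →ₗ[K] V) (hR : ∀ x y, nb (R x) (R y) = R (gb x y))
    (hgn : ∀ x y, gb x y = nb (R x) y + nb x (R y) + nb x y)
    (A : Submodule K V) (hA : IsLieIdeal K nb A) (hAb : ∀ x ∈ A, ∀ y ∈ A, nb x y = 0) :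
    A = ⊥ := by
  let := hg.lieRing
  let := hg.lieAlgebra
  have : IsKilling K V := hgss.isKilling hg
  let ρ : V →ₗ⁅K⁆ Module.End K V :=
    { hn.adj ∘ₗ R with
      map_lie' := by
        intro x y
        change hn.adj (R (gb x y)) = _
        rw [← hR, hn.adj_bracket]
        rfl }
  let σ : V →ₗ⁅K⁆ Module.End K V :=
    { hn.adj ∘ₗ (R + LinearMap.id) with
      map_lie' := by
        intro x y
        change hn.adj (R (gb x y) + gb x y) = ⁅hn.adj (R x + x), hn.adj (R y + y)⁆
        rw [← hn.adj_bracket, ← hR, hgn, (hn.1 _).map_add, (hn.2.1 _).map_add,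
          (hn.2.1 _).map_add]
        congr 1
        abel }
  have hρ (x : V) : ρ x = hn.adj (R x) := rfl
  have hσ (x : V) : σ x = hn.adj (R x) + hn.adj x := hn.adj.map_add (R x) x
  let ad' : V →ₗ⁅K⁆ Module.End K V := LieAlgebra.ad K V
  have htr (y : V) : LinearMap.trace K V (hn.adj y ∘ₗ R) = 0 := by
    have h1 := killing_trace_eq_zero ρ y
    have h2 := killing_trace_eq_zero σ y
    have h3 := killing_trace_eq_zero ad' y
    have h4 : ad' y = hn.adj (R y) + hn.adj y ∘ₗ R + hn.adj y := by
      ext z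
      exact hgn y z
    rw [hρ] at h1
    rw [hσ, map_add, h1, zero_add] at h2
    rwa [h4, map_add, map_add, h1, h2, zero_add, add_zero] at h3
  have hinj {u v : V} (h : hn.adj u = hn.adj v) : u = v := by
    refine sub_eq_zero.mp (hz _ fun y => ?_)
    rw [(hn.2.1 y).map_sub]
    exact sub_eq_zero.mpr (LinearMap.congr_fun h y)
  obtain ⟨p, hpA, hpid, hp⟩ := exists_projection_of_representation σ A fun x m hm => hA _ m hm
  obtain ⟨q, hqA, hqid, hq⟩ := exists_projection_of_representation
    ((LieAlgebra.ad K (Module.End K V)).comp ρ) (A.map hn.adj) (by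
      rintro x _ ⟨m, hm, rfl⟩
      exact ⟨nb (R x) m, hA _ m hm, hn.adj_bracket _ _⟩)
  obtain ⟨y₀, hy₀, hqp⟩ := hqA p
  have hbr (x : V) : q ⁅hn.adj x, p⁆ = hn.adj (nb y₀ (R x)) := by
    have h1 : ⁅σ x, p⁆ = 0 := by
      ext m
      simp [Ring.lie_def, hp]
    have h2 : ⁅hn.adj x, p⁆ = - ⁅ρ x, p⁆ := by
      rw [hσ, add_lie] at h1
      rw [hρ, eq_neg_iff_add_eq_zero, add_comm, h1]
    have h3 : q ⁅ρ x, p⁆ = ⁅ρ x, q p⁆ := hq x p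
    rw [h2, map_neg, h3, ← hqp, hρ, lie_skew, hn.adj_bracket]
  have hproj : LinearMap.IsProj A (-(hn.adj y₀ ∘ₗ R)) := by
    constructor
    · intro x
      obtain ⟨a, ha, hax⟩ := hqA ⁅hn.adj x, p⁆
      rw [hbr] at hax
      have := hinj hax
      change -(nb y₀ (R x)) ∈ A
      rw [← this]
      exact neg_mem ha
    · intro x hx
      have h1 : ⁅hn.adj x, p⁆ = - hn.adj x := by
        ext m
        have hxm : nb x m ∈ A := by
          rw [hn.skew]
          exact neg_mem (hA m x hx)
        simp [Ring.lie_def, hAb x hx _ (hpA m), hpid _ hxm]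
      have h2 := hbr x
      rw [h1, map_neg, hqid _ ⟨x, hx, rfl⟩, ← map_neg] at h2
      change -(nb y₀ (R x)) = x
      rw [← hinj h2, neg_neg]
  have hdim := hproj.trace
  rw [map_neg, htr, neg_zero] at hdim
  exact Submodule.finrank_eq_zero.mp (by exact_mod_cast hdim.symm)

end PostLie

theorem postLie_semisimple_complete {V : Type*} [AddCommGroup V] [Module ℂ V]
    [FiniteDimensional ℂ V]
    (gb nb : V → V → V) (hg : IsLieBr ℂ gb) (hn : IsLieBr ℂ nb)
    (hgss : IsSemisimpleBr ℂ gb) (hncomplete : IsCompleteLie ℂ nb)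
    (mul : V → V → V) (hpl : IsPostLie ℂ gb nb mul) :
    IsSemisimpleBr ℂ nb := by
  obtain ⟨R, hR, hgn⟩ := hpl.exists_operator hn hncomplete
  exact hn.isSemisimpleBr_of_abelian_ideals fun A hA hAb =>
    abelian_ideal_eq_bot_of_operator hg hn hgss hncomplete.1 R hR hgn A hA hAb
end
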